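/- arXiv:math-ph/0610026 — 3 statements merged into one kernel-verified Lean document; each statement's English description precedes it below -/
import Mathlib

section
/- Let Q be a pair probability measure on ℤ^d×ℤ^d with equal marginals, let Λ ⊂ ℤ^d be a finite nonempty set, let x₀ ∈ Λ, and let Q_Λ be defined as: Q_Λ(x,y) = Q(x,y) for x,y ∈ Λ∖{x₀}; Q_Λ(x,x₀) = Q⁽¹⁾(x) − ∑_{z∈Λ∖{x₀}} Q(x,z) for x ∈ Λ∖{x₀}; Q_Λ(x₀,y) = Q⁽¹⁾(y) − ∑_{z∈Λ∖{x₀}} Q(z,y) for y ∈ Λ∖{x₀}; Q_Λ(x₀,x₀) = 1 − ∑_{(x,y)∈Λ×Λ, (x,y)≠(x₀,x₀)} Q_Λ(x,y); and extend Q_Λ to ℤ^d×ℤ^d by setting Q_Λ(x,y) = 0 whenever (x,y) ∉ Λ×Λ. Then ∑_{x,y∈ℤ^d} |Q(x,y) − Q_Λ(x,y)| ≤ 2·∑_{(x,y)∉Λ×Λ} Q(x,y). In particular, if (Λ_N)_{N∈ℕ} is a sequence of finite sets with Λ_N ↑ ℤ^d, then ∑_{x,y∈ℤ^d} |Q(x,y)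 − Q_{Λ_N}(x,y)| → 0 as N → ∞. -/
open scoped BigOperators

/-- First marginal of a pair probability measure. -/
noncomputable def margin1 {S : Type*} (Q : S × S → ℝ) (x : S) : ℝ := ∑' y, Q (x, y)

/-- Second marginal of a pair probability measure. -/
noncomputable def margin2 {S : Type*} (Q : S × S → ℝ) (y : S) : ℝ := ∑' x, Q (x, y)

/-- `Q` is a pair probability measure: values in `[0,1]` and total mass `1`. -/
def IsPairPM {S : Type*} (Q : S × S → ℝ) : Prop :=
  (∀ p, 0 ≤ Q p ∧ Q p ≤ 1) ∧ HasSum Q 1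

/-- `Q` has equal first and second marginals. -/
def EqMarg {S : Type*} (Q : S × S → ℝ) : Prop := margin1 Q = margin2 Q

/-- The off-corner entries of the marginal construction `Q_Λ`. -/
noncomputable def QLamOff {S : Type*} [DecidableEq S]
    (Q : S × S → ℝ) (Λ : Finset S) (x₀ : S) (p : S × S) : ℝ :=
  if p.1 = x₀ then margin1 Q p.2 - ∑ z ∈ Λ.erase x₀, Q (z, p.2)
  else if p.2 = x₀ then margin1 Q p.1 - ∑ z ∈ Λ.erase x₀, Q (p.1, z)
  else Q p

/-- The marginal construction `Q_Λ`: it agrees with `Q` on `(Λ∖{x₀})²`, its rows and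
columns through `x₀` are fixed by the marginals of `Q`, the corner `(x₀,x₀)` makes the
total mass `1`, and it vanishes outside `Λ×Λ`. -/
noncomputable def QLam {S : Type*} [DecidableEq S]
    (Q : S × S → ℝ) (Λ : Finset S) (x₀ : S) (p : S × S) : ℝ :=
  if p.1 ∈ Λ ∧ p.2 ∈ Λ then
    if p = (x₀, x₀) then 1 - ∑ q ∈ (Λ ×ˢ Λ).erase (x₀, x₀), QLamOff Q Λ x₀ q
    else QLamOff Q Λ x₀ p
  else 0


section Marginals

variable {S : Type*} {Q : S × S → ℝ} {Λ : Finset S} {x₀ : S}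

lemma sum_le_margin1 (hQ : IsPairPM Q) (A : Finset S) (x : S) :
    ∑ z ∈ A, Q (x, z) ≤ margin1 Q x :=
  (hQ.2.summable.comp_injective (Prod.mk_right_injective x)).sum_le_tsum A
    fun z _ => (hQ.1 (x, z)).1

lemma sum_le_margin2 (hQ : IsPairPM Q) (A : Finset S) (y : S) :
    ∑ z ∈ A, Q (z, y) ≤ margin2 Q y :=
  (hQ.2.summable.comp_injective (Prod.mk_left_injective y)).sum_le_tsum A
    fun z _ => (hQ.1 (z, y)).1

variable [DecidableEq S]

/-- The mass of the row over `x` is the first marginal at `x`. -/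
lemma hasSum_margin1 (hQ : Summable Q) (x : S) :
    HasSum (fun p : S × S => if p.1 = x then Q p else 0) (margin1 Q x) := by
  have hinj : Function.Injective (fun y : S => (x, y)) := Prod.mk_right_injective x
  refine (hinj.hasSum_iff ?_).1 ?_
  · rintro ⟨a, b⟩ hab
    refine if_neg fun h => hab ⟨b, ?_⟩
    simp_all
  · simpa [Function.comp_def, margin1] using (hQ.comp_injective hinj).hasSum

/-- The mass of the column over `y` is the second marginal at `y`. -/
lemma hasSum_margin2 (hQ : Summable Q) (y : S) :
    HasSum (fun p : S × S => if p.2 = y then Q p else 0) (margin2 Q y) := by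
  have hinj : Function.Injective (fun x : S => (x, y)) := Prod.mk_left_injective y
  refine (hinj.hasSum_iff ?_).1 ?_
  · rintro ⟨a, b⟩ hab
    refine if_neg fun h => hab ⟨a, ?_⟩
    simp_all
  · simpa [Function.comp_def, margin2] using (hQ.comp_injective hinj).hasSum

/-- Inclusion-exclusion for the cross of rows and columns over `A`, to which a diagonal
point outside of `A` is added. -/
lemma sum_margins_sub_add_le_one (hQ : IsPairPM Q) {A : Finset S} (hx₀ : x₀ ∉ A) :
    ∑ x ∈ A, margin1 Q x + ∑ y ∈ A, margin2 Q y - ∑ p ∈ A ×ˢ A, Q p + Q (x₀, x₀) ≤ 1 := by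
  have hrow := hasSum_sum fun x (_ : x ∈ A) => hasSum_margin1 hQ.2.summable x
  have hcol := hasSum_sum fun y (_ : y ∈ A) => hasSum_margin2 hQ.2.summable y
  have hbox : HasSum (fun p => if p ∈ A ×ˢ A then Q p else 0) (∑ p ∈ A ×ˢ A, Q p) := by
    rw [← Finset.sum_congr rfl fun p hp => if_pos hp]
    exact hasSum_sum_of_ne_finset_zero fun p hp => if_neg hp
  have hcorner := hasSum_ite_eq (x₀, x₀) (Q (x₀, x₀))
  refine hasSum_le (fun p => ?_) (((hrow.add hcol).sub hbox).add hcorner) hQ.2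
  obtain ⟨x, y⟩ := p
  have hp := (hQ.1 (x, y)).1
  simp only [Finset.sum_ite_eq, Finset.mem_product, Prod.mk.injEq]
  clear hrow hcol hbox hcorner
  grind

/-- Splitting a sum over a square along the row and the column through `x₀`. -/
lemma sum_product_eq_sum_erase (hx₀ : x₀ ∈ Λ) (f : S × S → ℝ) :
    ∑ p ∈ Λ ×ˢ Λ, f p = ∑ p ∈ Λ.erase x₀ ×ˢ Λ.erase x₀, f p
      + ∑ x ∈ Λ.erase x₀, f (x, x₀) + ∑ y ∈ Λ.erase x₀, f (x₀, y) + f (x₀, x₀) := by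
  simp only [Finset.sum_product, ← Finset.sum_erase_add _ _ hx₀, Finset.sum_add_distrib]
  ring

/-- The mass of `Q_Λ` off the corner, in terms of the marginals of `Q`. -/
lemma sum_QLamOff (hQm : EqMarg Q) (hx₀ : x₀ ∈ Λ) :
    ∑ p ∈ (Λ ×ˢ Λ).erase (x₀, x₀), QLamOff Q Λ x₀ p =
      ∑ x ∈ Λ.erase x₀, margin1 Q x + ∑ y ∈ Λ.erase x₀, margin2 Q y
        - ∑ p ∈ Λ.erase x₀ ×ˢ Λ.erase x₀, Q p := by
  rw [Finset.sum_erase_eq_sub (Finset.mk_mem_product hx₀ hx₀), sum_product_eq_sum_erase hx₀]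
  have hbox : ∑ p ∈ Λ.erase x₀ ×ˢ Λ.erase x₀, QLamOff Q Λ x₀ p =
      ∑ p ∈ Λ.erase x₀ ×ˢ Λ.erase x₀, Q p := by
    refine Finset.sum_congr rfl fun p hp => ?_
    simp only [Finset.mem_product, Finset.mem_erase] at hp
    simp [QLamOff, hp.1.1, hp.2.1]
  have hcol : ∑ x ∈ Λ.erase x₀, QLamOff Q Λ x₀ (x, x₀) =
      ∑ x ∈ Λ.erase x₀, margin1 Q x - ∑ p ∈ Λ.erase x₀ ×ˢ Λ.erase x₀, Q p := by
    rw [Finset.sum_product, ← Finset.sum_sub_distrib]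
    refine Finset.sum_congr rfl fun x hx => ?_
    simp [QLamOff, (Finset.mem_erase.1 hx).1]
  have hrow : ∑ y ∈ Λ.erase x₀, QLamOff Q Λ x₀ (x₀, y) =
      ∑ y ∈ Λ.erase x₀, margin2 Q y - ∑ p ∈ Λ.erase x₀ ×ˢ Λ.erase x₀, Q p := by
    rw [Finset.sum_product_right, ← Finset.sum_sub_distrib, ← hQm]
    simp [QLamOff]
  rw [hbox, hcol, hrow]
  ring

lemma le_QLamOff (hQ : IsPairPM Q) (hQm : EqMarg Q) (hx₀ : x₀ ∈ Λ) {p : S × S}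
    (hp : p ∈ Λ ×ˢ Λ) : Q p ≤ QLamOff Q Λ x₀ p := by
  obtain ⟨x, y⟩ := p
  rw [QLamOff]
  split_ifs with hx hy
  · obtain rfl : x = x₀ := hx
    have h := sum_le_margin2 hQ Λ y
    rw [← hQm, ← Finset.sum_erase_add _ _ hx₀] at h
    dsimp only
    linarith
  · obtain rfl : y = x₀ := hy
    have h := sum_le_margin1 hQ Λ x
    rw [← Finset.sum_erase_add _ _ hx₀] at h
    dsimp only
    linarith
  · exact le_rfl

/-- `Q_Λ` dominates `Q` on `Λ × Λ`. -/
lemma le_QLam (hQ : IsPairPM Q) (hQm : EqMarg Q) (hx₀ : x₀ ∈ Λ) {p : S × S}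
    (hp : p ∈ Λ ×ˢ Λ) : Q p ≤ QLam Q Λ x₀ p := by
  rw [QLam, if_pos (Finset.mem_product.1 hp)]
  split_ifs with h
  · have := sum_margins_sub_add_le_one hQ (Finset.notMem_erase x₀ Λ)
    rw [h, sum_QLamOff hQm hx₀]
    linarith
  · exact le_QLamOff hQ hQm hx₀ hp

/-- `Q_Λ` has total mass one. -/
lemma sum_QLam (hx₀ : x₀ ∈ Λ) : ∑ p ∈ Λ ×ˢ Λ, QLam Q Λ x₀ p = 1 := by
  have hmem : (x₀, x₀) ∈ Λ ×ˢ Λ := Finset.mk_mem_product hx₀ hx₀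
  have hoff : ∑ p ∈ (Λ ×ˢ Λ).erase (x₀, x₀), QLam Q Λ x₀ p =
      ∑ p ∈ (Λ ×ˢ Λ).erase (x₀, x₀), QLamOff Q Λ x₀ p := by
    refine Finset.sum_congr rfl fun p hp => ?_
    obtain ⟨hne, hp⟩ := Finset.mem_erase.1 hp
    rw [QLam, if_pos (Finset.mem_product.1 hp), if_neg hne]
  rw [← Finset.sum_erase_add _ _ hmem, hoff, QLam, if_pos ⟨hx₀, hx₀⟩, if_pos rfl]
  ring

/-- The `L¹` distance between `Q` and `Q_Λ` is twice the mass of `Q` outside of `Λ × Λ`. -/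
lemma tsum_abs_sub_QLam (hQ : IsPairPM Q) (hQm : EqMarg Q) (hx₀ : x₀ ∈ Λ) :
    ∑' p, |Q p - QLam Q Λ x₀ p| = 2 * (1 - ∑ p ∈ Λ ×ˢ Λ, Q p) := by
  have hzero : ∀ p ∉ Λ ×ˢ Λ, QLam Q Λ x₀ p = 0 := fun p hp =>
    if_neg fun h => hp (Finset.mem_product.2 h)
  have hsum : Summable fun p => |Q p - QLam Q Λ x₀ p| :=
    (hQ.2.summable.sub (summable_of_ne_finset_zero hzero)).abs
  have hin : ∑ p ∈ Λ ×ˢ Λ, |Q p - QLam Q Λ x₀ p| = 1 - ∑ p ∈ Λ ×ˢ Λ, Q p := by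
    rw [← sum_QLam (Q := Q) hx₀, ← Finset.sum_sub_distrib]
    refine Finset.sum_congr rfl fun p hp => ?_
    rw [abs_sub_comm, abs_of_nonneg (sub_nonneg.2 (le_QLam hQ hQm hx₀ hp))]
  have hout : ∑' p : {p // p ∉ Λ ×ˢ Λ}, |Q p - QLam Q Λ x₀ p| =
      ∑' p : {p // p ∉ Λ ×ˢ Λ}, Q p :=
    tsum_congr fun p => by rw [hzero p p.2, sub_zero, abs_of_nonneg (hQ.1 p).1]
  have htot := hQ.2.summable.sum_add_tsum_subtype_compl (Λ ×ˢ Λ)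
  rw [hQ.2.tsum_eq] at htot
  rw [← hsum.sum_add_tsum_subtype_compl (Λ ×ˢ Λ), hin, hout]
  linarith

end Marginals

/-- L¹ approximation of `Q` by `Q_Λ` (extended by zero outside `Λ×Λ`),
and the resulting convergence along an exhausting sequence of finite sets. -/
theorem stmt3 (d : ℕ) (hd : 1 ≤ d)
    (Q : ((Fin d → ℤ) × (Fin d → ℤ)) → ℝ)
    (hQ : IsPairPM Q) (hQm : EqMarg Q)
    (Λ : Finset (Fin d → ℤ)) (hΛ : Λ.Nonempty)
    (x₀ : Fin d → ℤ) (hx₀ : x₀ ∈ Λ) :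
    (∑' p : (Fin d → ℤ) × (Fin d → ℤ), |Q p - QLam Q Λ x₀ p| ≤
        2 * ∑' p : {p : (Fin d → ℤ) × (Fin d → ℤ) // p ∉ Λ ×ˢ Λ}, Q ↑p) ∧
    (∀ (Λs : ℕ → Finset (Fin d → ℤ)) (x₀s : ℕ → (Fin d → ℤ)),
      Monotone Λs → (∀ x : Fin d → ℤ, ∃ N, x ∈ Λs N) →
      (∀ N, x₀s N ∈ Λs N) →
      Filter.Tendsto
        (fun N : ℕ =>
          ∑' p : (Fin d → ℤ) × (Fin d → ℤ), |Q p - QLam Q (Λs N) (x₀s N) p|)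
        Filter.atTop (nhds 0)) := by
  constructor
  · have htot := hQ.2.summable.sum_add_tsum_subtype_compl (Λ ×ˢ Λ)
    rw [hQ.2.tsum_eq] at htot
    rw [tsum_abs_sub_QLam hQ hQm hx₀]
    linarith
  · intro Λs x₀s hmono hex hmem
    simp only [fun N => tsum_abs_sub_QLam hQ hQm (hmem N)]
    have hbox : Filter.Tendsto (fun N => Λs N ×ˢ Λs N) Filter.atTop Filter.atTop := by
      refine Filter.tendsto_atTop_finset_of_monotone
        (fun M N h => Finset.product_subset_product (hmono h) (hmono h)) fun p => ?_
      obtain ⟨M, hM⟩ := hex p.1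
      obtain ⟨N, hN⟩ := hex p.2
      exact ⟨max M N, Finset.mem_product.2
        ⟨hmono (le_max_left M N) hM, hmono (le_max_right M N) hN⟩⟩
    have hlim : Filter.Tendsto (fun s : Finset ((Fin d → ℤ) × (Fin d → ℤ)) => ∑ p ∈ s, Q p)
        Filter.atTop (nhds 1) := hQ.2
    simpa using ((hlim.comp hbox).const_sub 1).const_mul 2
end

section
/- Let d ≥ 1, β > 0, let Λ ⊂ ℤ^d be a finite nonempty set, and let p : Λ → (0,1] be a probability measure on Λ with p(x) > 0 for all x ∈ Λ. Set u(x) = √(p(x)) for x ∈ Λ, and define the symmetric Λ×Λ real matrix A by A(x,y) = 1 if x ≠ y and |x−y| = 1, A(x,y) = 0 if x ≠ y and |x−y| ≠ 1, and A(x,x) = −(1/u(x))·∑_{y∈Λ, |x−y|=1} u(y). Then the function Q(x,y) := u(x)·u(y)·(exp(βA))(x,y), where exp denotes the matrix exponential, is a pair probability measure on Λ×Λ: Q(x,y) ≥ 0 for all x,y ∈ Λ, Q(x,y) = Q(y,x), ∑_{x,y∈Λ} Q(x,y) = 1, and both marginals of Q equal p, i.e. ∑_{y∈Λ} Q(x,y)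 = p(x) = ∑_{y∈Λ} Q(y,x) for every x ∈ Λ. -/
open scoped BigOperators

/-- Lattice (sup) distance on `ℤ^d`: `max_i |x_i − y_i|`. -/
def latDist {d : ℕ} (x y : Fin d → ℤ) : ℕ :=
  Finset.univ.sup fun i : Fin d => (x i - y i).natAbs

/-- Matrix exponential `exp(M) = ∑_{n≥0} M^n/n!`. -/
noncomputable def matExp {n : Type*} [Fintype n] [DecidableEq n]
    (M : Matrix n n ℝ) : Matrix n n ℝ :=
  ∑' k : ℕ, ((k.factorial : ℝ)⁻¹) • M ^ k

/-- The matrix `A` on `Λ`: off-diagonal entries are `1` between lattice neighbours and `0`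
otherwise; the diagonal entry at `x` is `−(1/u(x))·∑_{y∈Λ, |x−y|=1} u(y)` with `u = √p`. -/
noncomputable def Amat {d : ℕ} (Λ : Finset (Fin d → ℤ)) (p : (Fin d → ℤ) → ℝ) :
    Matrix {x : Fin d → ℤ // x ∈ Λ} {x : Fin d → ℤ // x ∈ Λ} ℝ :=
  Matrix.of fun x y =>
    if x = y then
      -(1 / Real.sqrt (p x)) *
        ∑ z ∈ Λ.attach.filter (fun z => latDist (x : Fin d → ℤ) z.1 = 1),
          Real.sqrt (p z)
    else if latDist (x : Fin d → ℤ) (y : Fin d → ℤ) = 1 then 1 else 0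

/-- The exponential series of a real square matrix converges entrywise to `matExp`. -/
theorem hasSum_matExp {n : Type*} [Fintype n] [DecidableEq n] (M : Matrix n n ℝ) :
    HasSum (fun k : ℕ => ((k.factorial : ℝ)⁻¹) • M ^ k) (matExp M) := by
  have h : Summable (fun k : ℕ => ((k.factorial : ℝ)⁻¹) • M ^ k) :=
    open scoped Matrix.Norms.Operator in
    (NormedSpace.exp_series_hasSum_exp' (𝕂 := ℝ) M).summable
  exact h.hasSum

theorem matExp_eq_exp {n : Type*} [Fintype n] [DecidableEq n] (M : Matrix n n ℝ) :
    matExp M = NormedSpace.exp M := by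
  rw [NormedSpace.exp_eq_tsum ℝ, matExp]

theorem matExp_apply_nonneg_of_nonneg {n : Type*} [Fintype n] [DecidableEq n]
    {M : Matrix n n ℝ} (hM : ∀ i j, 0 ≤ M i j) (i j : n) : 0 ≤ matExp M i j := by
  have hpow : ∀ (k : ℕ) (i j : n), 0 ≤ (M ^ k) i j := by
    intro k
    induction k with
    | zero =>
      intro i j
      rw [pow_zero, Matrix.one_apply]
      split_ifs <;> norm_num
    | succ k ih =>
      intro i j
      rw [pow_succ, Matrix.mul_apply]
      exact Finset.sum_nonneg fun l _ => mul_nonneg (ih i l) (hM l j)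
  have h := Pi.hasSum.1 (Pi.hasSum.1 (hasSum_matExp M) i) j
  exact h.nonneg fun k => mul_nonneg (by positivity) (hpow k i j)

/-- A matrix with nonnegative off-diagonal entries has an entrywise nonnegative exponential. -/
theorem matExp_apply_nonneg {n : Type*} [Fintype n] [DecidableEq n]
    {M : Matrix n n ℝ} (hM : ∀ i j, i ≠ j → 0 ≤ M i j) (i j : n) : 0 ≤ matExp M i j := by
  set c : ℝ := ∑ i, |M i i|
  set D : Matrix n n ℝ := Matrix.diagonal fun _ => -c
  have hN : ∀ i j, 0 ≤ (M - D) i j := by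
    intro i j
    rcases eq_or_ne i j with rfl | hij
    · have h1 : |M i i| ≤ c :=
        Finset.single_le_sum (f := fun i => |M i i|) (fun _ _ => abs_nonneg _) (Finset.mem_univ i)
      have h2 := neg_abs_le (M i i)
      simp only [D, Matrix.sub_apply, Matrix.diagonal_apply_eq]
      linarith
    · simpa [D, hij] using hM i j hij
  have hcomm : Commute (M - D) D := by
    have : D = Matrix.scalar n (-c) := rfl
    rw [this]
    exact (Matrix.scalar_commute (-c) (fun r => Commute.all _ r) _).symm
  have h : matExp M = matExp (M - D) * Matrix.diagonal (NormedSpace.exp fun _ : n => -c) := by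
    rw [matExp_eq_exp, matExp_eq_exp, ← Matrix.exp_diagonal,
      ← Matrix.exp_add_of_commute _ _ hcomm, sub_add_cancel]
  rw [h, Matrix.mul_diagonal, Pi.coe_exp, ← Real.exp_eq_exp_ℝ]
  exact mul_nonneg (matExp_apply_nonneg_of_nonneg hN i j) (Real.exp_pos _).le

theorem matExp_isSymm {n : Type*} [Fintype n] [DecidableEq n] {M : Matrix n n ℝ}
    (hM : M.IsSymm) : (matExp M).IsSymm := by
  rw [matExp_eq_exp]
  exact hM.exp

/-- A vector in the kernel of `M` is fixed by the exponential of `M`. -/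
theorem matExp_mulVec_of_mulVec_eq_zero {n : Type*} [Fintype n] [DecidableEq n]
    {M : Matrix n n ℝ} {v : n → ℝ} (hv : M.mulVec v = 0) : (matExp M).mulVec v = v := by
  have hcont : Continuous fun N : Matrix n n ℝ => N.mulVec v :=
    continuous_id.matrix_mulVec continuous_const
  have h := (hasSum_matExp M).map (⟨⟨fun N : Matrix n n ℝ => N.mulVec v, Matrix.zero_mulVec v⟩,
    fun A B => Matrix.add_mulVec A B v⟩ : Matrix n n ℝ →+ (n → ℝ)) hcont
  have h0 := hasSum_single (f := fun k : ℕ => (((k.factorial : ℝ)⁻¹) • M ^ k).mulVec v) 0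
    (fun k hk => by
      obtain ⟨m, rfl⟩ := Nat.exists_eq_succ_of_ne_zero hk
      rw [Matrix.smul_mulVec, Nat.succ_eq_add_one, pow_succ, ← Matrix.mulVec_mulVec, hv,
        Matrix.mulVec_zero, smul_zero])
  simpa using h.unique h0

theorem latDist_comm {d : ℕ} (x y : Fin d → ℤ) : latDist x y = latDist y x := by
  unfold latDist
  congr 1
  funext i
  rw [← Int.natAbs_neg, neg_sub]

theorem Amat_isSymm {d : ℕ} (Λ : Finset (Fin d → ℤ)) (p : (Fin d → ℤ) → ℝ) :
    (Amat Λ p).IsSymm := by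
  ext x y
  rcases eq_or_ne x y with rfl | hxy
  · rfl
  · simp [Amat, hxy, hxy.symm, latDist_comm y.1 x.1]

theorem Amat_mulVec_sqrt {d : ℕ} {Λ : Finset (Fin d → ℤ)} {p : (Fin d → ℤ) → ℝ}
    (hp : ∀ x ∈ Λ, 0 < p x) : (Amat Λ p).mulVec (fun x => Real.sqrt (p x)) = 0 := by
  funext x
  have hx : Real.sqrt (p x) ≠ 0 := (Real.sqrt_pos.2 (hp x x.2)).ne'
  have hself : latDist x.1 x.1 ≠ 1 := by
    have h : latDist x.1 x.1 = 0 := by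
      simp only [latDist, sub_self, Int.natAbs_zero]
      exact Finset.sup_bot _
    omega
  have hterm : ∀ y : {x // x ∈ Λ}, Amat Λ p x y * Real.sqrt (p y) =
      (if x = y then Amat Λ p x x * Real.sqrt (p x) else 0) +
        if latDist x.1 y.1 = 1 then Real.sqrt (p y) else 0 := by
    intro y
    rcases eq_or_ne x y with rfl | hxy
    · simp [hself]
    · simp [Amat, hxy]
  have hdiag : Amat Λ p x x * Real.sqrt (p x) =
      -∑ z ∈ Λ.attach.filter (fun z => latDist x.1 z.1 = 1), Real.sqrt (p z) := by
    simp only [Amat, Matrix.of_apply, if_true]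
    field_simp
  rw [Matrix.mulVec, dotProduct, Finset.sum_congr rfl fun y _ => hterm y,
    Finset.sum_add_distrib, Finset.sum_ite_eq, if_pos (Finset.mem_univ x), hdiag,
    ← Finset.sum_filter, Finset.univ_eq_attach, neg_add_cancel, Pi.zero_apply]

/-- `Q(x,y) = √p(x)·√p(y)·exp(βA)(x,y)` is a symmetric pair probability
measure on `Λ×Λ` whose two marginals are both equal to `p`. -/
theorem stmt12 (d : ℕ) (hd : 1 ≤ d) (β : ℝ) (hβ : 0 < β)
    (Λ : Finset (Fin d → ℤ)) (hΛ : Λ.Nonempty)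
    (p : (Fin d → ℤ) → ℝ)
    (hp : ∀ x ∈ Λ, 0 < p x ∧ p x ≤ 1) (hpsum : ∑ x ∈ Λ, p x = 1) :
    let Q : {x : Fin d → ℤ // x ∈ Λ} → {x : Fin d → ℤ // x ∈ Λ} → ℝ :=
      fun x y => Real.sqrt (p x) * Real.sqrt (p y) * matExp (β • Amat Λ p) x y
    (∀ x y, 0 ≤ Q x y) ∧
    (∀ x y, Q x y = Q y x) ∧
    (∑ x : {x : Fin d → ℤ // x ∈ Λ}, ∑ y : {x : Fin d → ℤ // x ∈ Λ}, Q x y = 1) ∧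
    (∀ x : {x : Fin d → ℤ // x ∈ Λ},
      (∑ y : {x : Fin d → ℤ // x ∈ Λ}, Q x y = p x) ∧
      (∑ y : {x : Fin d → ℤ // x ∈ Λ}, Q y x = p x)) := by
  intro Q
  have hsymm : ∀ x y, Q x y = Q y x := by
    intro x y
    have h := (matExp_isSymm ((Amat_isSymm Λ p).smul β)).apply x y
    simp only [Q, ← h]
    ring
  have hrow : ∀ x, ∑ y, Q x y = p x := by
    intro x
    have hker : (β • Amat Λ p).mulVec (fun x => Real.sqrt (p x)) = 0 := by
      rw [Matrix.smul_mulVec, Amat_mulVec_sqrt fun x hx => (hp x hx).1, smul_zero]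
    have h := congrFun (matExp_mulVec_of_mulVec_eq_zero hker) x
    calc ∑ y, Q x y
        = Real.sqrt (p x) * (matExp (β • Amat Λ p)).mulVec (fun x => Real.sqrt (p x)) x := by
          simp only [Q, Matrix.mulVec, dotProduct, Finset.mul_sum]
          exact Finset.sum_congr rfl fun y _ => by ring
      _ = p x := by rw [h, Real.mul_self_sqrt (hp x x.2).1.le]
  refine ⟨fun x y => ?_, hsymm, ?_, fun x => ⟨hrow x, ?_⟩⟩
  · refine mul_nonneg (by positivity) (matExp_apply_nonneg (fun i j hij => ?_) x y)
    simp only [Matrix.smul_apply, Amat, Matrix.of_apply, if_neg hij, smul_eq_mul]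
    split_ifs <;> simp [hβ.le]
  · simp only [hrow]
    rw [← hpsum]
    exact Finset.sum_coe_sort Λ p
  · simp only [fun y => hsymm y x, hrow]
end

section
/- Let d ≥ 1, let m be a probability measure on ℤ^d, and let g : ℤ^d × ℤ^d → ℝ satisfy c ≤ g(x,y) ≤ C for all x,y ∈ ℤ^d, for some constants 0 < c ≤ C < ∞. Then the infimum inf{ H(Q|Q⁽¹⁾⊗m) − ∑_{x,y∈ℤ^d} Q(x,y)·log g(x,y) : Q a pair probability measure on ℤ^d×ℤ^d with equal marginals } is attained: there exists a pair probability measure Q⁰ on ℤ^d×ℤ^d with equal marginals achieving the infimum. -/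
open scoped BigOperators

open Classical in
/-- Relative entropy `H(Q | Q⁽¹⁾ ⊗ m)`, with value `⊤` when `Q` charges a pair where
`Q⁽¹⁾(x)·m(y) = 0`, or when the defining series fails to be summable. -/
noncomputable def relEntropy {S : Type*} (Q : S × S → ℝ) (m : S → ℝ) : EReal :=
  if (∀ p : S × S, 0 < Q p → margin1 Q p.1 * m p.2 ≠ 0) ∧
     Summable (fun p : S × S => Q p * Real.log (Q p / (margin1 Q p.1 * m p.2)))
  then ((∑' p : S × S, Q p * Real.log (Q p / (margin1 Q p.1 * m p.2)) : ℝ) : EReal)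
  else ⊤

open Filter Topology InformationTheory

section PairMeasures

variable {S : Type*} {Q : S × S → ℝ} {m : S → ℝ}

namespace IsPairPM

theorem hasSum_margin1 (hQ : IsPairPM Q) : HasSum (margin1 Q) 1 :=
  hQ.2.prod_fiberwise fun x => (hQ.2.summable.prod_factor x).hasSum

theorem margin1_nonneg (hQ : IsPairPM Q) (x : S) : 0 ≤ margin1 Q x :=
  tsum_nonneg fun y => (hQ.1 (x, y)).1

theorem le_margin1 (hQ : IsPairPM Q) (p : S × S) : Q p ≤ margin1 Q p.1 :=
  (hQ.2.summable.prod_factor p.1).le_tsum p.2 fun y _ => (hQ.1 (p.1, y)).1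

theorem summable_mul (hQ : IsPairPM Q) {f : S × S → ℝ} {B : ℝ} (hf : ∀ p, |f p| ≤ B) :
    Summable fun p => Q p * f p := by
  refine Summable.of_norm_bounded (hQ.2.summable.mul_right B) fun p => ?_
  rw [Real.norm_eq_abs, abs_mul, abs_of_nonneg (hQ.1 p).1]
  exact mul_le_mul_of_nonneg_left (hf p) (hQ.1 p).1

theorem tsum_mul_le (hQ : IsPairPM Q) {f : S × S → ℝ} {B : ℝ} (hf : ∀ p, |f p| ≤ B) :
    ∑' p, Q p * f p ≤ B := by
  have h := hQ.2.mul_right B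
  rw [one_mul] at h
  exact hasSum_le (fun p => mul_le_mul_of_nonneg_left ((le_abs_self _).trans (hf p)) (hQ.1 p).1)
    (hQ.summable_mul hf).hasSum h

theorem tsum_mul_fst (hQ : IsPairPM Q) {f : S → ℝ} {B : ℝ} (hf : ∀ x, |f x| ≤ B) :
    ∑' p, Q p * f p.1 = ∑' x, margin1 Q x * f x := by
  rw [(hQ.summable_mul fun p => hf p.1).tsum_prod]
  exact tsum_congr fun x => tsum_mul_right (f := fun y => Q (x, y)) (a := f x)

theorem tsum_mul_snd (hQ : IsPairPM Q) {f : S → ℝ} {B : ℝ} (hf : ∀ x, |f x| ≤ B) :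
    ∑' p, Q p * f p.2 = ∑' y, margin2 Q y * f y := by
  rw [← (Equiv.prodComm S S).tsum_eq]
  have h := (Equiv.prodComm S S).summable_iff.2 (hQ.summable_mul fun p => hf p.2)
  rw [Summable.tsum_prod (f := fun p : S × S => Q ((Equiv.prodComm S S) p) *
    f ((Equiv.prodComm S S) p).2) h]
  exact tsum_congr fun y => tsum_mul_right (f := fun x => Q (x, y)) (a := f y)

end IsPairPM

/-- The terms `R · klFun (Q / R)` with `R = Q⁽¹⁾ ⊗ m`: a nonnegative rearrangement of the
relative entropy series. -/
noncomputable def klTerm (Q : S × S → ℝ) (m : S → ℝ) (p : S × S) : ℝ :=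
  margin1 Q p.1 * m p.2 * klFun (Q p / (margin1 Q p.1 * m p.2))

theorem klTerm_nonneg (hQ : IsPairPM Q) (hm : ∀ x, 0 ≤ m x) (p : S × S) : 0 ≤ klTerm Q m p := by
  have hR : 0 ≤ margin1 Q p.1 * m p.2 := mul_nonneg (hQ.margin1_nonneg _) (hm _)
  exact mul_nonneg hR (klFun_nonneg (div_nonneg (hQ.1 p).1 hR))

theorem hasSum_margin1_mul (hQ : IsPairPM Q) {u : S → ℝ} (hu : ∀ x, 0 ≤ u x) {a : ℝ}
    (h : HasSum u a) : HasSum (fun p : S × S => margin1 Q p.1 * u p.2) a := by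
  have h1 := hQ.hasSum_margin1
  have h2 := h1.mul h (h1.summable.mul_of_nonneg h.summable hQ.margin1_nonneg hu)
  rwa [one_mul] at h2

theorem relEntropy_eq_coe_iff (hQ : IsPairPM Q) (hm : ∀ x, 0 ≤ m x) (hm1 : HasSum m 1) (h : ℝ) :
    relEntropy Q m = (h : EReal) ↔
      (∀ p : S × S, 0 < Q p → margin1 Q p.1 * m p.2 ≠ 0) ∧ HasSum (klTerm Q m) h := by
  have hR := hasSum_margin1_mul hQ hm hm1
  have key : (∀ p : S × S, 0 < Q p → margin1 Q p.1 * m p.2 ≠ 0) →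
      ∀ p, klTerm Q m p = Q p * Real.log (Q p / (margin1 Q p.1 * m p.2)) +
        (margin1 Q p.1 * m p.2 - Q p) := by
    intro hac p
    unfold klTerm klFun
    by_cases hp : margin1 Q p.1 * m p.2 = 0
    · have : Q p = 0 := le_antisymm (not_lt.1 fun h => hac p h hp) (hQ.1 p).1
      simp [hp, this]
    · generalize margin1 Q p.1 * m p.2 = R at hp ⊢
      field_simp
      ring
  unfold relEntropy
  constructor
  · intro H
    split_ifs at H with hc
    · refine ⟨hc.1, ?_⟩
      have h1 := hc.2.hasSum.add (hR.sub hQ.2)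
      rw [EReal.coe_injective H, sub_self, add_zero] at h1
      exact h1.congr_fun (key hc.1)
    · exact absurd H (EReal.coe_ne_top h).symm
  · rintro ⟨hac, hs⟩
    have h1 : HasSum (fun p : S × S => Q p * Real.log (Q p / (margin1 Q p.1 * m p.2))) h := by
      have h2 := hs.sub (hR.sub hQ.2)
      rw [sub_self, sub_zero] at h2
      refine h2.congr_fun fun p => ?_
      rw [key hac p]
      ring
    rw [if_pos ⟨hac, h1.summable⟩, h1.tsum_eq]

theorem relEntropy_eq_top_or_coe (Q : S × S → ℝ) (m : S → ℝ) :
    relEntropy Q m = ⊤ ∨ ∃ h : ℝ, relEntropy Q m = (h : EReal) := by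
  unfold relEntropy
  split_ifs
  · exact Or.inr ⟨_, rfl⟩
  · exact Or.inl rfl

theorem mul_le_klFun_add_exp {t : ℝ} (ht : 0 ≤ t) (l : ℝ) : l * t ≤ klFun t + Real.exp l := by
  unfold klFun
  rcases ht.eq_or_lt with rfl | ht
  · simp [(Real.exp_pos l).le, add_nonneg]
  · have h := Real.add_one_le_exp (l - Real.log t)
    rw [Real.exp_sub, Real.exp_log ht, le_div_iff₀ ht] at h
    nlinarith

/-- Entropy inequality: the mass of the second marginal is controlled by the entropy and `m`. -/
theorem mul_tsum_snd_le (hQ : IsPairPM Q) (hm : ∀ x, 0 ≤ m x) (hm1 : HasSum m 1) {h : ℝ}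
    (hh : relEntropy Q m = (h : EReal)) {f : S → ℝ} (hf0 : ∀ x, 0 ≤ f x) (hf1 : ∀ x, f x ≤ 1)
    (l : ℝ) :
    l * ∑' p, Q p * f p.2 ≤ h + Real.exp l * ∑' y, m y * f y := by
  obtain ⟨hac, hs⟩ := (relEntropy_eq_coe_iff hQ hm hm1 h).1 hh
  have hmf : Summable fun y => m y * f y :=
    Summable.of_nonneg_of_le (fun y => mul_nonneg (hm y) (hf0 y))
      (fun y => mul_le_of_le_one_right (hm y) (hf1 y)) hm1.summable
  have hR := (hasSum_margin1_mul hQ (fun y => mul_nonneg (hm y) (hf0 y)) hmf.hasSum).mul_left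
    (Real.exp l)
  have hQf : Summable fun p => Q p * f p.2 :=
    hQ.summable_mul (B := 1) fun p => abs_le.2 ⟨by linarith [hf0 p.2], hf1 p.2⟩
  refine hasSum_le (fun p => ?_) (hQf.hasSum.mul_left l) (hs.add hR)
  have hR0 : 0 ≤ margin1 Q p.1 * m p.2 := mul_nonneg (hQ.margin1_nonneg _) (hm _)
  have hk := klTerm_nonneg hQ hm p
  have hpt : l * Q p ≤ klTerm Q m p + Real.exp l * (margin1 Q p.1 * m p.2) := by
    rcases hR0.eq_or_lt with h0 | h0
    · have : Q p = 0 := le_antisymm (not_lt.1 fun h => hac p h h0.symm) (hQ.1 p).1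
      rw [this, ← h0]
      simpa using hk
    · have h1 := mul_le_mul_of_nonneg_left
        (mul_le_klFun_add_exp (div_nonneg (hQ.1 p).1 hR0) l) hR0
      have h2 : margin1 Q p.1 * m p.2 * (l * (Q p / (margin1 Q p.1 * m p.2))) = l * Q p := by
        rw [mul_left_comm, mul_div_cancel₀ _ h0.ne']
      unfold klTerm
      linarith
  have h1 := mul_le_mul_of_nonneg_right hpt (hf0 p.2)
  have h2 := mul_le_of_le_one_right hk (hf1 p.2)
  linarith

/-- Uniform tightness of equal-marginal pair measures with bounded relative entropy. -/
theorem exists_finset_le_sum (hm : ∀ x, 0 ≤ m x) (hm1 : HasSum m 1) (K : ℝ) {ε : ℝ} (hε : 0 < ε) :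
    ∃ F : Finset (S × S), ∀ (Q : S × S → ℝ) (h : ℝ), IsPairPM Q → EqMarg Q →
      relEntropy Q m = (h : EReal) → h ≤ K → 1 - ε ≤ ∑ p ∈ F, Q p := by
  classical
  set L : ℝ := |K| + 1 with hL
  have hLpos : 0 < L := by positivity
  set l : ℝ := 4 * L / ε with hl
  have hlpos : 0 < l := by positivity
  have hδ : 0 < L / Real.exp l := by positivity
  obtain ⟨A, hA⟩ := (hm1.eventually (lt_mem_nhds (sub_lt_self 1 hδ))).exists
  set f : S → ℝ := fun x => if x ∈ A then 0 else 1 with hf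
  have hf0 : ∀ x, 0 ≤ f x := fun x => by simp only [hf]; split_ifs <;> norm_num
  have hf1 : ∀ x, f x ≤ 1 := fun x => by simp only [hf]; split_ifs <;> norm_num
  have hfa : ∀ x, |f x| ≤ 1 := fun x => abs_le.2 ⟨by linarith [hf0 x], hf1 x⟩
  have hmf : ∑' y, m y * f y ≤ L / Real.exp l := by
    have h1 : HasSum (fun y => if y ∈ A then m y else 0) (∑ y ∈ A, m y) := by
      have := hasSum_sum_of_ne_finset_zero (f := fun y => if y ∈ A then m y else 0) (s := A)
        (L := .unconditional S) (fun b hb => if_neg hb)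
      rwa [Finset.sum_congr rfl fun y hy => if_pos hy] at this
    have h2 : HasSum (fun y => m y * f y) (1 - ∑ y ∈ A, m y) := by
      refine (hm1.sub h1).congr_fun fun y => ?_
      simp only [hf]
      split_ifs <;> simp
    rw [h2.tsum_eq]
    linarith
  refine ⟨A ×ˢ A, fun Q h hQ hE hh hK => ?_⟩
  have hsnd : ∑' p, Q p * f p.2 ≤ ε / 2 := by
    have h1 := mul_tsum_snd_le hQ hm hm1 hh hf0 hf1 l
    have h2 : Real.exp l * ∑' y, m y * f y ≤ L := by
      rw [le_div_iff₀ (Real.exp_pos l)] at hmf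
      linarith
    have h3 : l * ∑' p, Q p * f p.2 ≤ l * (ε / 2) := by
      have : l * (ε / 2) = 2 * L := by
        rw [hl]
        field_simp
        ring
      linarith [le_abs_self K]
    exact le_of_mul_le_mul_left h3 hlpos
  have hfst : ∑' p, Q p * f p.1 ≤ ε / 2 := by
    rwa [hQ.tsum_mul_fst hfa, hE, ← hQ.tsum_mul_snd hfa]
  have hF : HasSum (fun p => if p ∈ A ×ˢ A then Q p else 0) (∑ p ∈ A ×ˢ A, Q p) := by
    have := hasSum_sum_of_ne_finset_zero (f := fun p => if p ∈ A ×ˢ A then Q p else 0)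
      (s := A ×ˢ A) (L := .unconditional (S × S)) (fun b hb => if_neg hb)
    rwa [Finset.sum_congr rfl fun y hy => if_pos hy] at this
  have hle := hasSum_le (fun p => ?_) hQ.2 ((hF.add
    (hQ.summable_mul fun p => hfa p.1).hasSum).add (hQ.summable_mul fun p => hfa p.2).hasSum)
  · linarith
  · have := (hQ.1 p).1
    simp only [hf, Finset.mem_product]
    by_cases h1 : p.1 ∈ A <;> by_cases h2 : p.2 ∈ A <;> simp [h1, h2, this]

/-- Scheffé: pointwise convergence of pair measures to a pair measure implies convergence of
integrals of bounded functions. -/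
theorem tendsto_tsum_mul {q : ℕ → S × S → ℝ} (hq : ∀ n, IsPairPM (q n)) (hQ : IsPairPM Q)
    (hlim : ∀ p, Tendsto (fun n => q n p) atTop (𝓝 (Q p))) {f : S × S → ℝ} {B : ℝ}
    (hf : ∀ p, |f p| ≤ B) :
    Tendsto (fun n => ∑' p, q n p * f p) atTop (𝓝 (∑' p, Q p * f p)) := by
  have hpos : Tendsto (fun n => ∑' p, max (Q p - q n p) 0) atTop (𝓝 0) := by
    have h := tendsto_tsum_of_dominated_convergence (𝓕 := atTop)
      (f := fun n p => max (Q p - q n p) 0) (g := fun _ => 0) hQ.2.summable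
      (fun p => by
        have := (tendsto_const_nhds (x := Q p)).sub (hlim p) |>.max
          (tendsto_const_nhds (x := (0 : ℝ)))
        simpa using this)
      (Eventually.of_forall fun n p => by
        rw [Real.norm_eq_abs, abs_of_nonneg (le_max_right _ _)]
        exact max_le (by linarith [((hq n).1 p).1]) (hQ.1 p).1)
    simpa using h
  refine tendsto_iff_norm_sub_tendsto_zero.2 (squeeze_zero (fun _ => norm_nonneg _) (fun n => ?_)
    (g := fun n => B * (2 * ∑' p, max (Q p - q n p) 0)) ?_)
  · have hs : Summable fun p => max (Q p - q n p) 0 :=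
      Summable.of_nonneg_of_le (fun p => le_max_right _ _)
        (fun p => max_le (by linarith [((hq n).1 p).1]) (hQ.1 p).1) hQ.2.summable
    have hd := ((hs.hasSum.mul_left 2).add ((hq n).2.sub hQ.2)).mul_left B
    rw [sub_self, add_zero] at hd
    rw [← ((hq n).summable_mul hf).tsum_sub (hQ.summable_mul hf)]
    refine tsum_of_norm_bounded hd fun p => ?_
    rw [← sub_mul, Real.norm_eq_abs, abs_mul, mul_comm]
    have habs : |q n p - Q p| = 2 * max (Q p - q n p) 0 + (q n p - Q p) := by
      rcases le_total (q n p) (Q p) with h | h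
      · rw [max_eq_left (by linarith), abs_of_nonpos (by linarith)]
        ring
      · rw [max_eq_right (by linarith), abs_of_nonneg (by linarith)]
        ring
    rw [← habs]
    exact mul_le_mul_of_nonneg_right (hf p) (abs_nonneg _)
  · simpa using (hpos.const_mul 2).const_mul B

theorem tendsto_margins {q : ℕ → S × S → ℝ} (hq : ∀ n, IsPairPM (q n)) (hQ : IsPairPM Q)
    (hlim : ∀ p, Tendsto (fun n => q n p) atTop (𝓝 (Q p))) (x : S) :
    Tendsto (fun n => margin1 (q n) x) atTop (𝓝 (margin1 Q x)) ∧
      Tendsto (fun n => margin2 (q n) x) atTop (𝓝 (margin2 Q x)) := by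
  classical
  have hfa : ∀ y, |(Pi.single x 1 : S → ℝ) y| ≤ 1 := fun y => by
    by_cases h : y = x <;> simp [h]
  have hsum : ∀ u : S → ℝ, ∑' y, u y * (Pi.single x 1 : S → ℝ) y = u x := fun u => by
    rw [tsum_eq_single x fun y hy => by simp [hy]]
    simp
  constructor
  · have h := tendsto_tsum_mul hq hQ hlim (f := fun p => (Pi.single x 1 : S → ℝ) p.1)
      fun p => hfa p.1
    simpa only [(hq _).tsum_mul_fst hfa, hQ.tsum_mul_fst hfa, hsum] using h
  · have h := tendsto_tsum_mul hq hQ hlim (f := fun p => (Pi.single x 1 : S → ℝ) p.2)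
      fun p => hfa p.2
    simpa only [(hq _).tsum_mul_snd hfa, hQ.tsum_mul_snd hfa, hsum] using h

/-- A pointwise limit of equal-marginal pair measures with bounded relative entropy is again a
pair measure: no mass escapes. -/
theorem isPairPM_of_tendsto (hm : ∀ x, 0 ≤ m x) (hm1 : HasSum m 1) {q : ℕ → S × S → ℝ}
    (hq : ∀ n, IsPairPM (q n)) (hE : ∀ n, EqMarg (q n)) {h : ℕ → ℝ}
    (hh : ∀ n, relEntropy (q n) m = (h n : EReal)) {K : ℝ} (hK : ∀ᶠ n in atTop, h n ≤ K)
    (hlim : ∀ p, Tendsto (fun n => q n p) atTop (𝓝 (Q p))) : IsPairPM Q := by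
  have h0 : ∀ p, 0 ≤ Q p := fun p => ge_of_tendsto' (hlim p) fun n => ((hq n).1 p).1
  have hle : ∀ p, Q p ≤ 1 := fun p => le_of_tendsto' (hlim p) fun n => ((hq n).1 p).2
  have hF : ∀ F : Finset (S × S), Tendsto (fun n => ∑ p ∈ F, q n p) atTop (𝓝 (∑ p ∈ F, Q p)) :=
    fun F => tendsto_finsetSum F fun p _ => hlim p
  refine ⟨fun p => ⟨h0 p, hle p⟩, hasSum_of_isLUB_of_nonneg 1 h0 ⟨?_, ?_⟩⟩
  · rintro _ ⟨F, rfl⟩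
    exact le_of_tendsto' (hF F) fun n => sum_le_hasSum F (fun p _ => ((hq n).1 p).1) (hq n).2
  · intro b hb
    refine le_of_forall_pos_le_add fun ε hε => ?_
    obtain ⟨F, hFε⟩ := exists_finset_le_sum hm hm1 K hε
    have h1 : 1 - ε ≤ ∑ p ∈ F, Q p := ge_of_tendsto (hF F) (hK.mono fun n hn =>
      hFε (q n) (h n) (hq n) (hE n) (hh n) hn)
    have h2 : ∑ p ∈ F, Q p ≤ b := hb ⟨F, rfl⟩
    linarith

/-- Lower semicontinuity of the relative entropy along pointwise convergent sequences. -/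
theorem exists_relEntropy_le_of_tendsto (hm : ∀ x, 0 ≤ m x) (hm1 : HasSum m 1)
    {q : ℕ → S × S → ℝ} (hq : ∀ n, IsPairPM (q n)) (hQ : IsPairPM Q) {h : ℕ → ℝ}
    (hh : ∀ n, relEntropy (q n) m = (h n : EReal)) {b : ℝ} (hb : Tendsto h atTop (𝓝 b))
    (hlim : ∀ p, Tendsto (fun n => q n p) atTop (𝓝 (Q p))) :
    ∃ a : ℝ, relEntropy Q m = (a : EReal) ∧ a ≤ b := by
  classical
  have hh' := fun n => (relEntropy_eq_coe_iff (hq n) hm hm1 (h n)).1 (hh n)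
  have hac : ∀ p : S × S, 0 < Q p → margin1 Q p.1 * m p.2 ≠ 0 := fun p hp => by
    obtain ⟨n, hn⟩ := ((hlim p).eventually (lt_mem_nhds hp)).exists
    exact mul_ne_zero (hp.trans_le (hQ.le_margin1 p)).ne'
      (right_ne_zero_of_mul ((hh' n).1 p hn))
  have hterm : ∀ p, margin1 Q p.1 * m p.2 ≠ 0 →
      Tendsto (fun n => klTerm (q n) m p) atTop (𝓝 (klTerm Q m p)) := fun p hp => by
    have hR := ((tendsto_margins hq hQ hlim p.1).1).mul_const (m p.2)
    exact hR.mul ((continuous_klFun.tendsto _).comp ((hlim p).div hR hp))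
  have hbound : ∀ F : Finset (S × S), ∑ p ∈ F, klTerm Q m p ≤ b := fun F => by
    have hz : ∑ p ∈ F with margin1 Q p.1 * m p.2 ≠ 0, klTerm Q m p = ∑ p ∈ F, klTerm Q m p :=
      Finset.sum_filter_of_ne fun p _ hp => by
        contrapose! hp
        simp [klTerm, hp]
    rw [← hz]
    refine le_of_tendsto_of_tendsto' (tendsto_finsetSum _ fun p hp =>
      hterm p (Finset.mem_filter.1 hp).2) hb fun n => ?_
    exact sum_le_hasSum _ (fun p _ => klTerm_nonneg (hq n) hm p) (hh' n).2
  have hs : Summable (klTerm Q m) := summable_of_sum_le (klTerm_nonneg hQ hm) hbound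
  exact ⟨_, (relEntropy_eq_coe_iff hQ hm hm1 _).2 ⟨hac, hs.hasSum⟩, hs.tsum_le_of_sum_le hbound⟩

/-- The product measure `m ⊗ m` is an equal-marginal pair measure of zero relative entropy. -/
theorem exists_relEntropy_eq_zero (hm : ∀ x, 0 ≤ m x ∧ m x ≤ 1) (hm1 : HasSum m 1) :
    ∃ Q : S × S → ℝ, IsPairPM Q ∧ EqMarg Q ∧ relEntropy Q m = ((0 : ℝ) : EReal) := by
  have h1 : margin1 (fun p : S × S => m p.1 * m p.2) = m := by
    funext x
    simp [margin1, tsum_mul_left, hm1.tsum_eq]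
  have h2 : margin2 (fun p : S × S => m p.1 * m p.2) = m := by
    funext x
    simp [margin2, tsum_mul_right, hm1.tsum_eq]
  have hQ : IsPairPM fun p : S × S => m p.1 * m p.2 := by
    refine ⟨fun p => ⟨mul_nonneg (hm _).1 (hm _).1, mul_le_one₀ (hm _).2 (hm _).1 (hm _).2⟩, ?_⟩
    have := hm1.mul hm1 (hm1.summable.mul_of_nonneg hm1.summable (fun x => (hm x).1)
      fun x => (hm x).1)
    rwa [one_mul] at this
  refine ⟨_, hQ, h1.trans h2.symm,
    (relEntropy_eq_coe_iff hQ (fun x => (hm x).1) hm1 0).2 ⟨?_, ?_⟩⟩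
  · intro p hp
    rw [h1]
    exact hp.ne'
  · refine hasSum_zero.congr_fun fun p => ?_
    unfold klTerm
    rw [h1]
    by_cases hp : m p.1 * m p.2 = 0
    · simp [hp]
    · simp [div_self hp, klFun_one]

/-- Existence of a minimizer of `H(Q | Q⁽¹⁾ ⊗ m) − ∑ Q f` for bounded `f`. -/
theorem exists_minimizer [Countable S] (hm : ∀ x, 0 ≤ m x ∧ m x ≤ 1) (hm1 : HasSum m 1)
    {f : S × S → ℝ} {B : ℝ} (hf : ∀ p, |f p| ≤ B) :
    ∃ Q0 : S × S → ℝ, IsPairPM Q0 ∧ EqMarg Q0 ∧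
      ∀ Q : S × S → ℝ, IsPairPM Q → EqMarg Q →
        relEntropy Q0 m - ((∑' p, Q0 p * f p : ℝ) : EReal) ≤
          relEntropy Q m - ((∑' p, Q p * f p : ℝ) : EReal) := by
  have hm0 : ∀ x, 0 ≤ m x := fun x => (hm x).1
  set V : Set ℝ := {r | ∃ (Q : S × S → ℝ) (h : ℝ), IsPairPM Q ∧ EqMarg Q ∧
    relEntropy Q m = (h : EReal) ∧ h - ∑' p, Q p * f p = r} with hV
  have hVne : V.Nonempty := by
    obtain ⟨Q, hQ, hE, h0⟩ := exists_relEntropy_eq_zero hm hm1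
    exact ⟨_, Q, 0, hQ, hE, h0, rfl⟩
  have hVbdd : BddBelow V := by
    refine ⟨-B, ?_⟩
    rintro _ ⟨Q, h, hQ, hE, hh, rfl⟩
    have h1 := ((relEntropy_eq_coe_iff hQ hm0 hm1 h).1 hh).2.nonneg (klTerm_nonneg hQ hm0)
    linarith [hQ.tsum_mul_le hf]
  obtain ⟨r, -, hr, hrV⟩ := exists_seq_tendsto_sInf hVne hVbdd
  choose q h hq hE hh hqr using hrV
  obtain ⟨Q0, -, φ, hφ, hlim⟩ := (isCompact_univ_pi fun _ : S × S =>
    isCompact_Icc (a := (0 : ℝ)) (b := 1)).tendsto_subseq fun n p _ => (hq n).1 p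
  rw [tendsto_pi_nhds] at hlim
  have hr' := hr.comp hφ.tendsto_atTop
  have hK : ∀ᶠ n in atTop, h (φ n) ≤ sInf V + 1 + B := by
    filter_upwards [hr'.eventually (gt_mem_nhds (lt_add_one (sInf V)))] with n hn
    have h1 := (hq (φ n)).tsum_mul_le hf
    have h2 := hqr (φ n)
    simp only [Function.comp_apply] at hn
    linarith
  have hQ0 : IsPairPM Q0 := isPairPM_of_tendsto hm0 hm1 (fun n => hq (φ n)) (fun n => hE (φ n))
    (fun n => hh (φ n)) hK hlim
  have hE0 : EqMarg Q0 := by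
    funext x
    have h1 := tendsto_margins (fun n => hq (φ n)) hQ0 hlim x
    refine tendsto_nhds_unique h1.1 (h1.2.congr fun n => ?_)
    exact (congrFun (hE (φ n)) x).symm
  have hb : Tendsto (fun n => h (φ n)) atTop (𝓝 (sInf V + ∑' p, Q0 p * f p)) := by
    refine (hr'.add (tendsto_tsum_mul (fun n => hq (φ n)) hQ0 hlim hf)).congr fun n => ?_
    simp [← hqr (φ n)]
  obtain ⟨a, ha, hab⟩ := exists_relEntropy_le_of_tendsto hm0 hm1 (fun n => hq (φ n)) hQ0
    (fun n => hh (φ n)) hb hlim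
  refine ⟨Q0, hQ0, hE0, fun Q hQ hE => ?_⟩
  rcases relEntropy_eq_top_or_coe Q m with htop | ⟨b, hb⟩
  · rw [htop, EReal.top_sub_coe]
    exact le_top
  · rw [ha, hb, ← EReal.coe_sub, ← EReal.coe_sub, EReal.coe_le_coe_iff]
    have : sInf V ≤ b - ∑' p, Q p * f p := csInf_le hVbdd ⟨Q, b, hQ, hE, hb, rfl⟩
    linarith

end PairMeasures

/-- the variational formula `inf_Q { H(Q|Q⁽¹⁾⊗m) − ∑ Q·log g }` over pair
probability measures on `ℤ^d×ℤ^d` with equal marginals is attained. -/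
theorem stmt19 (d : ℕ) (hd : 1 ≤ d)
    (m : (Fin d → ℤ) → ℝ) (hm01 : ∀ x, 0 ≤ m x ∧ m x ≤ 1) (hm1 : HasSum m 1)
    (g : ((Fin d → ℤ) × (Fin d → ℤ)) → ℝ) (c C : ℝ)
    (hc : 0 < c) (hcC : c ≤ C)
    (hgl : ∀ p, c ≤ g p) (hgu : ∀ p, g p ≤ C) :
    ∃ Q0 : ((Fin d → ℤ) × (Fin d → ℤ)) → ℝ,
      IsPairPM Q0 ∧ EqMarg Q0 ∧
      ∀ Q : ((Fin d → ℤ) × (Fin d → ℤ)) → ℝ, IsPairPM Q → EqMarg Q →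
        relEntropy Q0 m - ((∑' p, Q0 p * Real.log (g p) : ℝ) : EReal) ≤
          relEntropy Q m - ((∑' p, Q p * Real.log (g p) : ℝ) : EReal) := by
  refine exists_minimizer hm01 hm1 (f := fun p => Real.log (g p))
    (B := max |Real.log c| |Real.log C|) fun p => ?_
  exact abs_le_max_abs_abs (Real.log_le_log hc (hgl p))
    (Real.log_le_log (hc.trans_le (hgl p)) (hgu p))
end
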